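/- Let k ≥ 1, X ∈ FIN_k^[∞], n ∈ ℕ, and let c : A X_n → l be a coloring with finitely many colors (l ∈ ℕ). Then there exists Y ≤ X such that c is constant on A Y_n. -/

import Mathlib

open scoped Classical

/-- `x` is a `k`-vector: values `≤ k`, finite support, attains the value `k`. -/
def IsFin (k : ℕ) (x : ℕ → ℕ) : Prop :=
  (∀ n, x n ≤ k) ∧ {n | x n ≠ 0}.Finite ∧ ∃ n, x n = k

/-- `x < y` as blocks: every point of the support of `x` lies below every
point of the support of `y`. -/
def VecLt (x y : ℕ → ℕ) : Prop := ∀ m n, x m ≠ 0 → y n ≠ 0 → m < n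

/-- An infinite block sequence of `k`-vectors. -/
def IsBlockSeq (k : ℕ) (X : ℕ → ℕ → ℕ) : Prop :=
  (∀ n, IsFin k (X n)) ∧ ∀ n, VecLt (X n) (X (n + 1))

/-- `T^i x (n) = max (x n - i) 0` (truncated subtraction on `ℕ`). -/
def Tmap (i : ℕ) (x : ℕ → ℕ) : ℕ → ℕ := fun n => x n - i

/-- `w` lies in the combinatorial subspace generated by the terms `X n`, `n ∈ I`:
it is a sum `T^{e n₀} x_{n₀} + ⋯ + T^{e nₘ} x_{nₘ}` with all `e n ≤ k` and at
least one `e n = 0`. -/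
def InSubspaceOn (k : ℕ) (X : ℕ → ℕ → ℕ) (I : Set ℕ) (w : ℕ → ℕ) : Prop :=
  ∃ (s : Finset ℕ) (e : ℕ → ℕ), ↑s ⊆ I ∧ s.Nonempty ∧ (∀ n ∈ s, e n ≤ k) ∧
    (∃ n ∈ s, e n = 0) ∧ w = fun m => ∑ n ∈ s, Tmap (e n) (X n) m

/-- `w ∈ ⟨X⟩`. -/
def InSubspace (k : ℕ) (X : ℕ → ℕ → ℕ) (w : ℕ → ℕ) : Prop :=
  InSubspaceOn k X Set.univ w

/-- `Y ≤ X` : `Y` is a block sequence all of whose terms lie in `⟨X⟩`. -/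
def BlockLE (k : ℕ) (Y X : ℕ → ℕ → ℕ) : Prop :=
  IsBlockSeq k Y ∧ ∀ n, InSubspace k X (Y n)

/-- `r_n(X)`, the first `n` terms of `X`, as a list. -/
def restrictN (X : ℕ → ℕ → ℕ) (n : ℕ) : List (ℕ → ℕ) := (List.range n).map X

/-- `𝒜X_n = { r_n(Y) : Y ≤ X }`. -/
def ApproxN (k : ℕ) (X : ℕ → ℕ → ℕ) (n : ℕ) : Set (List (ℕ → ℕ)) :=
  {s | ∃ Y, BlockLE k Y X ∧ s = restrictN Y n}

/-- `𝒜X = ⋃ n, 𝒜X_n`. -/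
def Approx (k : ℕ) (X : ℕ → ℕ → ℕ) : Set (List (ℕ → ℕ)) :=
  ⋃ n, ApproxN k X n

/-- `F` is a front on `[∅, X]`. -/
def IsFront (k : ℕ) (X : ℕ → ℕ → ℕ) (F : Set (List (ℕ → ℕ))) : Prop :=
  F ⊆ Approx k X ∧ (∀ Y, BlockLE k Y X → ∃ n, restrictN Y n ∈ F) ∧
    ∀ s ∈ F, ∀ t ∈ F, s <+: t → s = t

/-- `F̂` : the set of initial segments of members of `F`. -/
def FrontHat (F : Set (List (ℕ → ℕ))) : Set (List (ℕ → ℕ)) :=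
  {t | ∃ s ∈ F, t <+: s}

/-- `x` lies beyond (the supports of) all terms of the finite block sequence `s`. -/
def AfterList (s : List (ℕ → ℕ)) (x : ℕ → ℕ) : Prop := ∀ y ∈ s, VecLt y x

/-- `X` separates `s` and `t` (with respect to the coloring `f` of the front `F`):
whenever `s⌢w, t⌢v ∈ F↾X` with `w` from `⟨X/s⟩` and `v` from `⟨X/t⟩`,
the `f`-colors differ. -/
def Separates {α : Type*} (k : ℕ) (f : List (ℕ → ℕ) → α) (F : Set (List (ℕ → ℕ)))
    (X : ℕ → ℕ → ℕ) (s t : List (ℕ → ℕ)) : Prop :=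
  ∀ w v : List (ℕ → ℕ),
    (∀ x ∈ w, InSubspace k X x ∧ AfterList s x) →
    (∀ x ∈ v, InSubspace k X x ∧ AfterList t x) →
    s ++ w ∈ F → s ++ w ∈ Approx k X →
    t ++ v ∈ F → t ++ v ∈ Approx k X →
    f (s ++ w) ≠ f (t ++ v)

/-- `X` mixes `s` with `t` : no `Y ≤ X` separates `s` and `t`. -/
def Mixes {α : Type*} (k : ℕ) (f : List (ℕ → ℕ) → α) (F : Set (List (ℕ → ℕ)))
    (X : ℕ → ℕ → ℕ) (s t : List (ℕ → ℕ)) : Prop :=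
  ∀ Y, BlockLE k Y X → ¬ Separates k f F Y s t

/-- `depth_X(s)` : the least `n` with `s ≤ r_n(X)` (`∞` if none exists); this least
`n` is exactly the unique `n` with `s ≤_fin r_n(X)`. -/
noncomputable def depth (k : ℕ) (X : ℕ → ℕ → ℕ) (s : List (ℕ → ℕ)) : ℕ∞ :=
  sInf {m : ℕ∞ | ∃ n : ℕ, m = (n : ℕ∞) ∧ ∀ x ∈ s, InSubspaceOn k X (Set.Iio n) x}

/-- `min_i w` : the least point where `w` takes the value `i` (junk value if none). -/
noncomputable def minIdx (i : ℕ) (w : ℕ → ℕ) : ℕ := sInf {n | w n = i}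

/-- `max_i w` : the largest point where `w` takes the value `i` (junk value if none). -/
noncomputable def maxIdx (i : ℕ) (w : ℕ → ℕ) : ℕ := sSup {n | w n = i}

/-- The vector with value `i` at `min_i w` and `0` elsewhere. -/
noncomputable def minVec (i : ℕ) (w : ℕ → ℕ) : ℕ → ℕ :=
  fun n => if n = minIdx i w then i else 0

/-- The vector with value `i` at `max_i w` and `0` elsewhere. -/
noncomputable def maxVec (i : ℕ) (w : ℕ → ℕ) : ℕ → ℕ :=
  fun n => if n = maxIdx i w then i else 0

/-- `θ⁰_{i,l}(w) = {(n,l) : n ∈ (min_i w, min_{i+1} w), w n = l}`. -/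
noncomputable def theta0 (i l : ℕ) (w : ℕ → ℕ) : ℕ → ℕ :=
  fun n => if minIdx i w < n ∧ n < minIdx (i + 1) w ∧ w n = l then l else 0

/-- `θ¹_{i,l}(w) = {(n,l) : n ∈ (max_{i+1} w, max_i w), w n = l}`. -/
noncomputable def theta1 (i l : ℕ) (w : ℕ → ℕ) : ℕ → ℕ :=
  fun n => if maxIdx (i + 1) w < n ∧ n < maxIdx i w ∧ w n = l then l else 0

/-- `θ²_l(w) = {(n,l) : n ∈ (min_k w, max_k w), w n = l}`. -/
noncomputable def theta2 (k l : ℕ) (w : ℕ → ℕ) : ℕ → ℕ :=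
  fun n => if minIdx k w < n ∧ n < maxIdx k w ∧ w n = l then l else 0

def Gmin (k : ℕ) : Set ((ℕ → ℕ) → ℕ → ℕ) := {g | ∃ i, 1 ≤ i ∧ i ≤ k ∧ g = minVec i}
def Gmax (k : ℕ) : Set ((ℕ → ℕ) → ℕ → ℕ) := {g | ∃ i, 1 ≤ i ∧ i ≤ k ∧ g = maxVec i}
def Gmid0 (k : ℕ) : Set ((ℕ → ℕ) → ℕ → ℕ) :=
  {g | ∃ i l, 1 ≤ i ∧ i ≤ k - 1 ∧ 1 ≤ l ∧ l ≤ i - 1 ∧ g = theta0 i l}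
def Gmid1 (k : ℕ) : Set ((ℕ → ℕ) → ℕ → ℕ) :=
  {g | ∃ i l, 1 ≤ i ∧ i ≤ k - 1 ∧ 1 ≤ l ∧ l ≤ i - 1 ∧ g = theta1 i l}
def Gmid (k : ℕ) : Set ((ℕ → ℕ) → ℕ → ℕ) :=
  {g | (∃ l, 1 ≤ l ∧ l ≤ k ∧ g = theta2 k l) ∨ g = fun _ _ => 0}

/-- The family `𝒢` of elementary staircase maps. -/
def Gfam (k : ℕ) : Set ((ℕ → ℕ) → ℕ → ℕ) :=
  Gmin k ∪ Gmax k ∪ Gmid0 k ∪ Gmid1 k ∪ Gmid k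

/-- A staircase function : a member of the lattice closure of `𝒢` under the
pointwise join `(f ∨ g)(w) = f(w) ∨ g(w)`. -/
inductive IsStaircase (k : ℕ) : ((ℕ → ℕ) → ℕ → ℕ) → Prop
  | base (g : (ℕ → ℕ) → ℕ → ℕ) (hg : g ∈ Gfam k) : IsStaircase k g
  | join (f g : (ℕ → ℕ) → ℕ → ℕ) (hf : IsStaircase k f) (hg : IsStaircase k g) :
      IsStaircase k (fun w n => max (f w n) (g w n))

/-- `x` is a system of staircases (sos). -/
def IsSos (k : ℕ) (x : ℕ → ℕ) : Prop :=
  IsFin k x ∧ Set.range x = Set.Iic k ∧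
  (∀ i j, 1 ≤ i → i < j → j ≤ k → minIdx i x < minIdx j x ∧ minIdx j x < maxIdx i x) ∧
  ∀ i, 1 ≤ i → i ≤ k →
    x '' Set.Ico (minIdx (i - 1) x) (minIdx i x) = Set.Iic (i - 1) ∧
    x '' Set.Ioc (maxIdx i x) (maxIdx (i - 1) x) = Set.Iic (i - 1) ∧
    x '' Set.Icc (minIdx k x) (maxIdx k x) = Set.Iic k

/-- `x ⊆ y` as sets of ordered pairs `{(n, x n) : x n ≠ 0}`. -/
def VecSub (x y : ℕ → ℕ) : Prop := ∀ n, x n ≠ 0 → x n = y n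

/-- `a` is contained in `b` coordinatewise (as sets of ordered pairs), after
matching `a` with a sublist of `b` of the same length. -/
def ListInner (a b : List (ℕ → ℕ)) : Prop :=
  ∃ b' : List (ℕ → ℕ), b'.Sublist b ∧ a.length = b'.length ∧
    ∀ i < a.length, VecSub (a.getD i (fun _ => 0)) (b'.getD i (fun _ => 0))

/-- The value `φ_s(w)` for a family of (possibly empty) maps `Φ`. -/
def phiVal (Φ : List (ℕ → ℕ) → Option ((ℕ → ℕ) → ℕ → ℕ)) (s : List (ℕ → ℕ))
    (w : ℕ → ℕ) : Option (ℕ → ℕ) :=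
  (Φ s).map fun g => g w

/-- The inner map `φ(s) = ⋃_{s' ⊑ s} φ_{s'}(s(|s'|))`, the concatenation of the
values `φ_{r_i(s)}(s(i))` over those `i < |s|` with `φ_{r_i(s)} ≠ ∅`. -/
def innerMap (Φ : List (ℕ → ℕ) → Option ((ℕ → ℕ) → ℕ → ℕ)) (s : List (ℕ → ℕ)) :
    List (ℕ → ℕ) :=
  (List.range s.length).filterMap fun i =>
    (Φ (s.take i)).map fun g => g (s.getD i (fun _ => 0))

/-- `X` weakly mixes `s` with `t`, witnessed by the vector `w` (`w = w_s^t`). -/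
def WeaklyMixesWith (k : ℕ) (f : List (ℕ → ℕ) → ℕ) (F : Set (List (ℕ → ℕ)))
    (X : ℕ → ℕ → ℕ) (s t : List (ℕ → ℕ)) (w : ℕ → ℕ) : Prop :=
  depth k X s < depth k X t ∧ w ∈ t ∧ w ∉ s ∧
  ∀ Y, BlockLE k Y X →
    (∃ Z, BlockLE k Z Y ∧ restrictN Z s.length = s) →
    (∃ Z, BlockLE k Z Y ∧ restrictN Z t.length = t) →
    ∃ sbar tbar : List (ℕ → ℕ), sbar ∈ F ∩ Approx k Y ∧ tbar ∈ F ∩ Approx k Y ∧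
      t <+: tbar ∧
      (∃ v, InSubspace k Y v ∧ VecLt w v ∧ (s ++ [fun n => w n + v n]) <+: sbar) ∧
      f sbar = f tbar

/-- `c` is a tuple of combinations `T^{i_0} t_{i_0} + ⋯ + T^{i_l} t_{i_l}` of the
terms of `t`, lying in `⟨X⟩`, with pairwise disjoint sets of indices (each term
of `t` appears in at most one combination). -/
def IsComb (k : ℕ) (X : ℕ → ℕ → ℕ) (t c : List (ℕ → ℕ)) : Prop :=
  ∃ (I : ℕ → Finset ℕ) (e : ℕ → ℕ → ℕ),
    (∀ m < c.length,
      (I m).Nonempty ∧ (∀ j ∈ I m, j < t.length) ∧ (∀ j ∈ I m, e m j ≤ k) ∧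
      (∃ j ∈ I m, e m j = 0) ∧
      c.getD m (fun _ => 0) =
        (fun n => ∑ j ∈ I m, Tmap (e m j) (t.getD j (fun _ => 0)) n) ∧
      InSubspace k X (c.getD m (fun _ => 0))) ∧
    ∀ m < c.length, ∀ m' < c.length, m ≠ m' → Disjoint (I m) (I m')

/-- The Suslin operation applied to a scheme indexed by finite sequences. -/
def SuslinOp {α : Type*} (P : List ℕ → Set α) : Set α :=
  ⋃ x : ℕ → ℕ, ⋂ n : ℕ, P ((List.range n).map x)

/-- The basic (open) sets `[s, X]` of the space `FIN_k^[∞]`. -/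
def BasicOpen (k : ℕ) : Set (Set (ℕ → ℕ → ℕ)) :=
  {B | ∃ (s : List (ℕ → ℕ)) (X : ℕ → ℕ → ℕ), IsBlockSeq k X ∧ s ∈ Approx k X ∧
    B = {Y | BlockLE k Y X ∧ restrictN Y s.length = s}}

/-- The topology on `FIN_k^[∞]` generated by the basic sets `[s, X]`. -/
def finkTop (k : ℕ) : TopologicalSpace (ℕ → ℕ → ℕ) :=
  TopologicalSpace.generateFrom (BasicOpen k)

/-- The smallest σ-field containing the closed sets and closed under the
Suslin operation. -/
inductive InSuslinField {α : Type*} (T : TopologicalSpace α) : Set α → Prop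
  | closed (s : Set α) (hs : @IsClosed α T s) : InSuslinField T s
  | compl (s : Set α) (hs : InSuslinField T s) : InSuslinField T sᶜ
  | iUnion (g : ℕ → Set α) (hg : ∀ n, InSuslinField T (g n)) : InSuslinField T (⋃ n, g n)
  | suslin (P : List ℕ → Set α) (hP : ∀ u, InSuslinField T (P u)) :
      InSuslinField T (SuslinOp P)


open Filter

/-- Vectors with the semigroup operation of pointwise maximum, which agrees with the sum
of vectors of disjoint supports. -/
def SupVec : Type := ℕ → ℕ

namespace SupVec

instance : Semigroup SupVec where
  mul x y := fun n => max (x n) (y n)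
  mul_assoc x y z := funext fun n => max_assoc (x n) (y n) (z n)

instance : Zero SupVec := ⟨fun _ => 0⟩

theorem mul_apply (x y : SupVec) (n : ℕ) : (x * y) n = max (x n) (y n) := rfl

theorem zero_apply (n : ℕ) : (0 : SupVec) n = 0 := rfl

theorem zero_mul' (x : SupVec) : 0 * x = x :=
  funext fun n => by simp [mul_apply, zero_apply]

/-- `Tmap` as a self-map of `SupVec`. -/
def shift (i : ℕ) (x : SupVec) : SupVec := Tmap i x

theorem shift_apply (i : ℕ) (x : SupVec) (n : ℕ) : shift i x n = x n - i := rfl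

theorem shift_mul (i : ℕ) (x y : SupVec) : shift i (x * y) = shift i x * shift i y := by
  funext n
  simp only [mul_apply, shift_apply]
  omega

theorem shift_zero (x : SupVec) : shift 0 x = x := rfl

theorem shift_shift (i j : ℕ) (x : SupVec) : shift i (shift j x) = shift (j + i) x := by
  funext n
  simp only [shift_apply]
  omega

theorem mul_comm' (x y : SupVec) : x * y = y * x :=
  funext fun n => max_comm (x n) (y n)

theorem isFin_mul {i j : ℕ} (hij : i ≤ j) {x y : SupVec} (hx : IsFin j x) (hy : IsFin i y) :
    IsFin j (x * y) := by
  obtain ⟨hx1, hx2, n, hn⟩ := hx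
  obtain ⟨hy1, hy2, -⟩ := hy
  refine ⟨fun m => max_le (hx1 m) ((hy1 m).trans hij), (hx2.union hy2).subset fun m hm => ?_, n, ?_⟩
  · by_contra h
    simp only [Set.mem_union, Set.mem_ofPred_eq, not_or, not_not] at h
    exact hm (by rw [mul_apply, h.1, h.2, max_self])
  · rw [mul_apply, hn]
    exact max_eq_left ((hy1 n).trans hij)

attribute [local instance] Ultrafilter.mul Ultrafilter.semigroup

theorem map_mul_of_hom {f : SupVec → SupVec} (hf : ∀ x y, f (x * y) = f x * f y)
    (U V : Ultrafilter SupVec) : (U * V).map f = U.map f * V.map f := by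
  refine Ultrafilter.coe_inj.mp (Filter.ext' fun p => ?_)
  rw [Ultrafilter.eventually_mul, Ultrafilter.coe_map, Filter.eventually_map,
    Ultrafilter.eventually_mul]
  simp only [Ultrafilter.coe_map, Filter.eventually_map, hf]

/-- The identities an idempotent ultrafilter on `FIN_j` has to satisfy together with its shifts. -/
def ShiftAbsorbing (U : Ultrafilter SupVec) : Prop :=
  ∀ i, U * U.map (shift i) = U ∧ U.map (shift i) * U = U

/-- The ultrafilter concentrates on `FIN_j`, beyond every given bound. -/
def IsCofinalFin (j : ℕ) (U : Ultrafilter SupVec) : Prop :=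
  (∀ᶠ x : SupVec in U, IsFin j x) ∧ ∀ M, ∀ᶠ x : SupVec in U, ∀ p ≤ M, x p = 0

theorem IsCofinalFin.mul_of_le {i j : ℕ} {U V : Ultrafilter SupVec} (hU : IsCofinalFin j U)
    (hV : IsCofinalFin i V) (hij : i ≤ j) :
    IsCofinalFin j (U * V) ∧ IsCofinalFin j (V * U) := by
  refine ⟨⟨(Ultrafilter.eventually_mul U V _).2 ?_, fun M =>
    (Ultrafilter.eventually_mul U V _).2 ?_⟩, ⟨(Ultrafilter.eventually_mul V U _).2 ?_, fun M =>
    (Ultrafilter.eventually_mul V U _).2 ?_⟩⟩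
  · filter_upwards [hU.1] with x hx
    filter_upwards [hV.1] with y hy using isFin_mul hij hx hy
  · filter_upwards [hU.2 M] with x hx
    filter_upwards [hV.2 M] with y hy p hp
    rw [mul_apply, hx p hp, hy p hp, max_self]
  · filter_upwards [hV.1] with x hx
    filter_upwards [hU.1] with y hy
    rw [mul_comm']
    exact isFin_mul hij hy hx
  · filter_upwards [hV.2 M] with x hx
    filter_upwards [hU.2 M] with y hy p hp
    rw [mul_apply, hx p hp, hy p hp, max_self]

theorem isClosed_isCofinalFin (j : ℕ) : IsClosed {U | IsCofinalFin j U} := by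
  have : {U | IsCofinalFin j U} = {U : Ultrafilter SupVec | {x : SupVec | IsFin j x} ∈ U} ∩
      ⋂ M, {U : Ultrafilter SupVec | {x : SupVec | ∀ p ≤ M, x p = 0} ∈ U} := by
    ext U
    simp only [Set.mem_inter_iff, Set.mem_iInter]
    exact Iff.rfl
  rw [this]
  exact (ultrafilter_isClosed_basic _).inter
    (isClosed_iInter fun M => ultrafilter_isClosed_basic _)

theorem isClosed_map_eq (f : SupVec → SupVec) (U : Ultrafilter SupVec) :
    IsClosed {V : Ultrafilter SupVec | V.map f = U} := by
  have : {V : Ultrafilter SupVec | V.map f = U} =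
      ⋂ A ∈ U, {V : Ultrafilter SupVec | f ⁻¹' A ∈ V} := by
    ext V
    simp only [Set.mem_iInter]
    constructor
    · rintro rfl A hA
      exact hA
    · intro h
      exact Ultrafilter.eq_of_le fun A hA => h A hA
  rw [this]
  exact isClosed_biInter fun A _ => ultrafilter_isClosed_basic _

/-- A section of `shift 1` on vectors, using `m` to reach the level of the new maximum
even when `x = 0`. -/
def raise (x : SupVec) (m : ℕ) : SupVec :=
  fun n => max (if x n = 0 then 0 else x n + 1) (if n = m then 1 else 0)

theorem shift_raise (x : SupVec) (m : ℕ) : shift 1 (raise x m) = x := by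
  funext n
  simp only [shift_apply, raise]
  split_ifs <;> omega

theorem isFin_raise {j : ℕ} {x : SupVec} (hx : IsFin j x) (m : ℕ) :
    IsFin (j + 1) (raise x m) := by
  obtain ⟨h1, h2, p, hp⟩ := hx
  refine ⟨fun n => ?_, (h2.union (Set.finite_singleton m)).subset fun n hn => ?_, ?_⟩
  · have := h1 n
    simp only [raise]
    split_ifs <;> omega
  · by_contra h
    simp only [Set.mem_union, Set.mem_ofPred_eq, Set.mem_singleton_iff, not_or, not_not] at h
    exact hn (by simp [raise, h.1, h.2])
  · rcases Nat.eq_zero_or_pos j with rfl | hj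
    · refine ⟨m, ?_⟩
      simp [raise, Nat.le_zero.1 (h1 m)]
    · refine ⟨p, ?_⟩
      simp only [raise, hp]
      split_ifs <;> omega

theorem exists_isCofinalFin_map_shift {j : ℕ} {U : Ultrafilter SupVec} (hU : IsCofinalFin j U) :
    ∃ V, IsCofinalFin (j + 1) V ∧ V.map (shift 1) = U := by
  let V : Ultrafilter SupVec := U.bind fun x => (hyperfilter ℕ).map (raise x)
  have key : ∀ p : SupVec → Prop,
      (∀ᶠ y in V, p y) ↔ ∀ᶠ x in U, ∀ᶠ m in (hyperfilter ℕ : Filter ℕ), p (raise x m) :=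
    fun p => Iff.rfl
  refine ⟨V, ⟨(key _).2 ?_, fun M => (key _).2 ?_⟩, ?_⟩
  · filter_upwards [hU.1] with x hx
    exact Eventually.of_forall fun m => isFin_raise hx m
  · filter_upwards [hU.2 M] with x hx
    have : ∀ᶠ m in (hyperfilter ℕ : Filter ℕ), M < m :=
      Nat.hyperfilter_le_atTop (eventually_gt_atTop M)
    filter_upwards [this] with m hm p hp
    have : p ≠ m := by omega
    simp [raise, hx p hp, this]
  · refine Ultrafilter.coe_inj.mp (Filter.ext' fun p => ?_)
    rw [Ultrafilter.coe_map, Filter.eventually_map, key]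
    simp only [shift_raise, eventually_const]

theorem ShiftAbsorbing.self_mul {U : Ultrafilter SupVec} (h : ShiftAbsorbing U) : U * U = U :=
  (h 0).1

/-- The ultrafilter form of Gowers' theorem. -/
theorem exists_shiftAbsorbing (k : ℕ) :
    ∃ U : Ultrafilter SupVec, IsCofinalFin k U ∧ ShiftAbsorbing U := by
  induction k with
  | zero =>
    have h0 : ∀ i, shift i 0 = 0 := fun i => funext fun n => by simp [shift_apply, zero_apply]
    have h00 : (pure 0 * pure 0 : Ultrafilter SupVec) = pure 0 := by
      refine Ultrafilter.coe_inj.mp (Filter.ext' fun p => ?_)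
      rw [Ultrafilter.eventually_mul]
      simp [zero_mul']
    refine ⟨pure 0, ⟨?_, fun M => ?_⟩, fun i => ?_⟩
    · exact ⟨fun _ => le_rfl, by simp [zero_apply], 0, rfl⟩
    · exact fun p _ => rfl
    · rw [Ultrafilter.map_pure, h0]
      exact ⟨h00, h00⟩
  | succ j ih =>
    obtain ⟨U, hU, hUs⟩ := ih
    let S : Set (Ultrafilter SupVec) := {V | IsCofinalFin (j + 1) V} ∩ {V | V.map (shift 1) = U}
    have hScl : IsClosed S := (isClosed_isCofinalFin _).inter (isClosed_map_eq _ _)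
    obtain ⟨V₀, hV₀⟩ : S.Nonempty := exists_isCofinalFin_map_shift hU
    have hU1 := hUs 1
    have hUU : U * U = U := hUs.self_mul
    have hmap : ∀ A B : Ultrafilter SupVec,
        (A * B).map (shift 1) = A.map (shift 1) * B.map (shift 1) :=
      map_mul_of_hom (shift_mul 1)
    have hUV : ∀ V ∈ S, U * V ∈ S := fun V hV => by
      refine ⟨(hV.1.mul_of_le hU j.le_succ).2, ?_⟩
      change (U * V).map (shift 1) = U
      rw [hmap, hV.2]
      exact hU1.2
    have hVU : ∀ V ∈ S, V * U ∈ S := fun V hV => by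
      refine ⟨(hV.1.mul_of_le hU j.le_succ).1, ?_⟩
      change (V * U).map (shift 1) = U
      rw [hmap, hV.2]
      exact hU1.1
    have hVV : ∀ V ∈ S, ∀ W ∈ S, V * W ∈ S := fun V hV W hW => by
      refine ⟨(hV.1.mul_of_le hW.1 le_rfl).1, ?_⟩
      change (V * W).map (shift 1) = U
      rw [hmap, hV.2, hW.2, hUU]
    obtain ⟨W, ⟨V, hV, rfl⟩, hW⟩ := exists_idempotent_in_compact_subsemigroup
      (M := Ultrafilter SupVec) Ultrafilter.continuous_mul_left ((· * U) '' S)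
      ⟨_, V₀, hV₀, rfl⟩ (hScl.isCompact.image (Ultrafilter.continuous_mul_left U)) (by
        rintro _ ⟨A, hA, rfl⟩ _ ⟨B, hB, rfl⟩
        exact ⟨A * U * B, hVV _ (hVU A hA) _ hB, by simp only [mul_assoc]⟩)
    replace hW : V * U * (V * U) = V * U := hW
    set W := U * (V * U) with hWdef
    have hWS : W ∈ S := hUV _ (hVU _ hV)
    have hUW : U * W = W := by rw [hWdef, ← mul_assoc, hUU]
    have hWU : W * U = W := by rw [hWdef, mul_assoc, mul_assoc, hUU]
    have hWW : W * W = W := by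
      calc W * W = U * (V * U * U * (V * U)) := by simp only [hWdef, mul_assoc]
        _ = W := by rw [mul_assoc V U U, hUU, hW]
    refine ⟨W, hWS.1, fun i => ?_⟩
    rcases i with _ | i
    · exact ⟨hWW, hWW⟩
    · have : W.map (shift (i + 1)) = U.map (shift i) := by
        rw [← hWS.2, Ultrafilter.map_map]
        congr 1
        funext x
        rw [Function.comp_apply, shift_shift, Nat.add_comm]
      rw [this]
      constructor
      · rw [← hWU, mul_assoc, (hUs i).1]
      · rw [← hUW, ← mul_assoc, (hUs i).2]

end SupVec

section BlockSequences

open SupVec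

variable {k : ℕ} {X : ℕ → ℕ → ℕ}

theorem IsFin.exists_eq {x : ℕ → ℕ} (hx : IsFin k x) : ∃ n, x n = k := hx.2.2

theorem IsBlockSeq.vecLt (hk : 1 ≤ k) (hX : IsBlockSeq k X) {i j : ℕ} (hij : i < j) :
    VecLt (X i) (X j) := by
  induction j, hij using Nat.le_induction with
  | base => exact hX.2 i
  | succ j _ ih =>
    intro m n hm hn
    obtain ⟨p, hp⟩ := (hX.1 j).exists_eq
    exact (ih m p hm (by omega)).trans (hX.2 j p n (by omega) hn)

theorem IsBlockSeq.eq_of_ne_zero (hk : 1 ≤ k) (hX : IsBlockSeq k X) {i j m : ℕ}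
    (hi : X i m ≠ 0) (hj : X j m ≠ 0) : i = j := by
  rcases lt_trichotomy i j with h | h | h
  · exact absurd (hX.vecLt hk h m m hi hj) (lt_irrefl m)
  · exact h
  · exact absurd (hX.vecLt hk h m m hj hi) (lt_irrefl m)

/-- The index of the term of `X` whose support contains `m` (`0` if there is none). -/
noncomputable def blockIndex (X : ℕ → ℕ → ℕ) (m : ℕ) : ℕ :=
  if h : ∃ n, X n m ≠ 0 then h.choose else 0

theorem IsBlockSeq.blockIndex_eq (hk : 1 ≤ k) (hX : IsBlockSeq k X) {n m : ℕ} (h : X n m ≠ 0) :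
    blockIndex X m = n := by
  have hex : ∃ n, X n m ≠ 0 := ⟨n, h⟩
  rw [blockIndex, dif_pos hex]
  exact hX.eq_of_ne_zero hk hex.choose_spec h

/-- The combination of the terms of `X` with exponents `k - w n`. -/
noncomputable def realize (k : ℕ) (X : ℕ → ℕ → ℕ) (w : SupVec) : SupVec :=
  fun m => X (blockIndex X m) m + w (blockIndex X m) - k

theorem IsBlockSeq.realize_mul (hX : IsBlockSeq k X) (v w : SupVec) :
    realize k X (v * w) = realize k X v * realize k X w := by
  funext m
  have := (hX.1 (blockIndex X m)).1 m
  simp only [realize, mul_apply]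
  omega

theorem IsBlockSeq.realize_shift (hX : IsBlockSeq k X) (i : ℕ) (w : SupVec) :
    realize k X (shift i w) = shift i (realize k X w) := by
  funext m
  have := (hX.1 (blockIndex X m)).1 m
  simp only [realize, shift_apply]
  omega

theorem IsBlockSeq.inSubspace_realize (hk : 1 ≤ k) (hX : IsBlockSeq k X) {w : SupVec}
    (hw : IsFin k w) : InSubspace k X (realize k X w) := by
  obtain ⟨h1, h2, n, hn⟩ := hw
  refine ⟨h2.toFinset, fun n => k - w n, Set.subset_univ _, ⟨n, ?_⟩, fun m _ => Nat.sub_le _ _,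
    ⟨n, ?_, by simp [hn]⟩, ?_⟩
  · rw [Set.Finite.mem_toFinset]
    change w n ≠ 0
    omega
  · rw [Set.Finite.mem_toFinset]
    change w n ≠ 0
    omega
  · funext m
    have hb := (hX.1 (blockIndex X m)).1 m
    have hw' := h1 (blockIndex X m)
    rw [Finset.sum_eq_single (blockIndex X m)]
    · simp only [realize, Tmap]
      omega
    · intro i _ hi
      have : X i m = 0 := by
        by_contra h
        exact hi (hX.blockIndex_eq hk h).symm
      simp [Tmap, this]
    · intro hi
      have : w (blockIndex X m) = 0 := by
        by_contra h
        exact hi ((Set.Finite.mem_toFinset h2).2 h)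
      simp only [Tmap, this]
      omega

theorem IsBlockSeq.isFin_realize (hk : 1 ≤ k) (hX : IsBlockSeq k X) {w : SupVec}
    (hw : IsFin k w) : IsFin k (realize k X w) := by
  obtain ⟨h1, h2, n, hn⟩ := hw
  refine ⟨fun m => ?_, (h2.biUnion fun i _ => (hX.1 i).2.1).subset fun m hm => ?_, ?_⟩
  · have := (hX.1 (blockIndex X m)).1 m
    have := h1 (blockIndex X m)
    simp only [realize]
    omega
  · have h3 := (hX.1 (blockIndex X m)).1 m
    have h4 := h1 (blockIndex X m)
    have h5 : X (blockIndex X m) m + w (blockIndex X m) - k ≠ 0 := hm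
    refine Set.mem_biUnion (x := blockIndex X m) ?_ ?_
    · change w (blockIndex X m) ≠ 0
      omega
    · change X (blockIndex X m) m ≠ 0
      omega
  · obtain ⟨p, hp⟩ := (hX.1 n).exists_eq
    refine ⟨p, ?_⟩
    simp only [realize, hX.blockIndex_eq hk (n := n) (m := p) (by omega), hp, hn]
    omega

attribute [local instance] Ultrafilter.mul Ultrafilter.semigroup

theorem IsBlockSeq.exists_shiftAbsorbing (hX : IsBlockSeq k X) :
    ∃ U : Ultrafilter SupVec, ShiftAbsorbing U ∧
      (∀ᶠ y : SupVec in U, ∃ v : SupVec, IsFin k v ∧ y = realize k X v) ∧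
      ∀ M, ∀ᶠ y : SupVec in U, ∀ p ≤ M, y p = 0 := by
  obtain ⟨U, ⟨hU1, hU2⟩, hUs⟩ := SupVec.exists_shiftAbsorbing k
  refine ⟨U.map (realize k X), fun i => ?_, ?_, fun M => ?_⟩
  · have hcomm : (U.map (realize k X)).map (shift i) = (U.map (shift i)).map (realize k X) := by
      rw [Ultrafilter.map_map, Ultrafilter.map_map]
      congr 1
      funext w
      exact (hX.realize_shift i w).symm
    rw [hcomm, ← map_mul_of_hom hX.realize_mul, ← map_mul_of_hom hX.realize_mul, (hUs i).1,
      (hUs i).2]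
    exact ⟨rfl, rfl⟩
  · rw [Ultrafilter.coe_map, Filter.eventually_map]
    filter_upwards [hU1] with v hv using ⟨v, hv, rfl⟩
  · rw [Ultrafilter.coe_map, Filter.eventually_map]
    filter_upwards [hU2 ((Finset.range (M + 1)).sup (blockIndex X))] with v hv p hp
    have h1 := hv (blockIndex X p)
      (Finset.le_sup (f := blockIndex X) (Finset.mem_range.2 (Nat.lt_succ_of_le hp)))
    have h2 := (hX.1 (blockIndex X p)).1 p
    simp only [realize, h1]
    omega

/-- The sum of the first `r` terms of `Y` with exponents `E`. -/
def partialSum (Y : ℕ → ℕ → ℕ) (E : ℕ → ℕ) (r : ℕ) : SupVec :=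
  fun p => ∑ i ∈ Finset.range r, Tmap (E i) (Y i) p

variable {Y : ℕ → ℕ → ℕ}

theorem IsBlockSeq.partialSum_succ (hk : 1 ≤ k) (hY : IsBlockSeq k Y) (E : ℕ → ℕ) (r : ℕ) :
    partialSum Y E (r + 1) = partialSum Y E r * shift (E r) (Y r) := by
  funext p
  rw [mul_apply, partialSum, Finset.sum_range_succ]
  change partialSum Y E r p + shift (E r) (Y r) p = _
  by_cases h : Y r p = 0
  · have : shift (E r) (Y r) p = 0 := by
      change Y r p - E r = 0
      rw [h, Nat.zero_sub]
    rw [this, Nat.add_zero, Nat.max_zero]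
  · have : partialSum Y E r p = 0 := Finset.sum_eq_zero fun i hi => by
      have hi' : i ≠ r := (Finset.mem_range.1 hi).ne
      have : Y i p = 0 := by
        by_contra h'
        exact hi' (hY.eq_of_ne_zero hk h' h)
      simp [Tmap, this]
    rw [this, Nat.zero_add, Nat.zero_max]

theorem IsBlockSeq.partialSum_eq_zero (hY : IsBlockSeq k Y) {E : ℕ → ℕ} {r : ℕ}
    (h : ∀ i < r, k ≤ E i) : partialSum Y E r = 0 := by
  funext p
  refine Finset.sum_eq_zero fun i hi => ?_
  have h1 := h i (Finset.mem_range.1 hi)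
  have h2 := (hY.1 i).1 p
  simp only [Tmap]
  omega

theorem IsBlockSeq.exists_partialSum (hk : 1 ≤ k) (hY : IsBlockSeq k Y) {z : ℕ → ℕ}
    (hz : InSubspace k Y z) : ∃ (E : ℕ → ℕ) (b : ℕ), (∀ i, E i ≤ k) ∧ E b < k ∧
      (∀ i, E i < k → i ≤ b) ∧ z = partialSum Y E (b + 1) := by
  obtain ⟨s, e, -, -, hek, ⟨n, hns, hn⟩, rfl⟩ := hz
  let E : ℕ → ℕ := fun i => if i ∈ s then e i else k
  have hEs : ∀ i, E i < k → i ∈ s := fun i hi => by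
    by_contra h
    simp [E, h] at hi
  have hfin : (s.filter fun i => E i < k).Nonempty :=
    ⟨n, Finset.mem_filter.2 ⟨hns, by simp only [E, hns, if_true]; omega⟩⟩
  obtain ⟨b, hb, hmax⟩ := Finset.exists_max_image _ id hfin
  have hmax' : ∀ i, E i < k → i ≤ b := fun i hi =>
    hmax i (Finset.mem_filter.2 ⟨hEs i hi, hi⟩)
  refine ⟨E, b, fun i => ?_, (Finset.mem_filter.1 hb).2, hmax', ?_⟩
  · by_cases h : i ∈ s
    · simpa [E, h] using hek i h
    · simp [E, h]
  · have hzero : ∀ i p, ¬ E i < k → Tmap (E i) (Y i) p = 0 := fun i p hi => by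
      have := (hY.1 i).1 p
      simp only [Tmap]
      omega
    funext p
    calc ∑ i ∈ s, Tmap (e i) (Y i) p = ∑ i ∈ s, Tmap (E i) (Y i) p :=
          Finset.sum_congr rfl fun i hi => by simp only [E, hi, if_true]
      _ = ∑ i ∈ s.filter fun i => E i < k, Tmap (E i) (Y i) p := by
          refine (Finset.sum_filter_of_ne fun i _ h => ?_).symm
          by_contra h'
          exact h (hzero i p h')
      _ = ∑ i ∈ Finset.range (b + 1), Tmap (E i) (Y i) p := by
          refine Finset.sum_subset (fun i hi => ?_) fun i _ hi => hzero i p fun h => ?_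
          · exact Finset.mem_range.2 (Nat.lt_succ_of_le (hmax' i (Finset.mem_filter.1 hi).2))
          · exact hi (Finset.mem_filter.2 ⟨hEs i h, h⟩)

theorem InSubspace.of_realize (hk : 1 ≤ k) (hX : IsBlockSeq k X) (hY : IsBlockSeq k Y)
    (hYX : ∀ i, ∃ v : SupVec, IsFin k v ∧ Y i = realize k X v) {z : ℕ → ℕ}
    (hz : InSubspace k Y z) (hzk : IsFin k z) : InSubspace k X z := by
  obtain ⟨E, b, -, -, -, hzE⟩ := hY.exists_partialSum hk hz
  have key : ∀ r, ∃ v : SupVec, (∀ n, v n ≤ k) ∧ {n | v n ≠ 0}.Finite ∧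
      partialSum Y E r = realize k X v := by
    intro r
    induction r with
    | zero =>
      refine ⟨0, fun _ => Nat.zero_le k, by simp [zero_apply], ?_⟩
      funext m
      have := (hX.1 (blockIndex X m)).1 m
      simp only [partialSum, realize, zero_apply, Finset.range_zero, Finset.sum_empty]
      omega
    | succ r ih =>
      obtain ⟨v, h1, h2, hv⟩ := ih
      obtain ⟨u, hu, huY⟩ := hYX r
      refine ⟨v * shift (E r) u, fun n => ?_, (h2.union hu.2.1).subset fun n hn => ?_, ?_⟩
      · have := hu.1 n
        exact max_le (h1 n) ((Nat.sub_le _ _).trans this)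
      · by_contra h
        simp only [Set.mem_union, Set.mem_ofPred_eq, not_or, not_not] at h
        exact hn (by rw [mul_apply, shift_apply, h.1, h.2, Nat.zero_sub, max_self])
      · rw [hY.partialSum_succ hk, hv, huY, hX.realize_mul, hX.realize_shift]
  obtain ⟨v, h1, h2, hv⟩ := key (b + 1)
  rw [hzE, hv]
  refine hX.inSubspace_realize hk ⟨h1, h2, ?_⟩
  obtain ⟨m, hm⟩ := hzk.exists_eq
  refine ⟨blockIndex X m, ?_⟩
  have h3 : X (blockIndex X m) m + v (blockIndex X m) - k = k := by
    rw [hzE, hv] at hm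
    exact hm
  have h4 := (hX.1 (blockIndex X m)).1 m
  have h5 := h1 (blockIndex X m)
  omega

end BlockSequences

section Fusion

open SupVec

/-- Along a sequence chosen generically for `U`, every run of finitely many transitions
preserves a property that `U`-almost every transition preserves. -/
theorem exists_generic_sequence {V σ T : Type*} [Finite T] (U : Ultrafilter V)
    (trans : T → σ → V → σ) (Q : σ → Prop)
    (hQ : ∀ st, Q st → ∀ t, ∀ᶠ y in U, Q (trans t st y)) (B : V → Prop)
    (hB : ∀ᶠ y in U, B y) (R : V → V → Prop) (hR : ∀ y, B y → ∀ᶠ y' in U, R y y')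
    (st₀ : σ) (h₀ : Q st₀) :
    ∃ (Y : ℕ → V) (S : ℕ → Set σ), (∀ n, B (Y n)) ∧ (∀ n, R (Y n) (Y (n + 1))) ∧
      st₀ ∈ S 0 ∧ (∀ m st t, st ∈ S m → trans t st (Y m) ∈ S (m + 1)) ∧
      ∀ m, ∀ st ∈ S m, Q st := by
  let D := {p : Set σ × V // p.1.Finite ∧ (∀ st ∈ p.1, Q st) ∧
    (∀ st ∈ p.1, ∀ t, Q (trans t st p.2)) ∧ B p.2}
  have hgen : ∀ A : Set σ, A.Finite → (∀ st ∈ A, Q st) →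
      ∀ᶠ y in U, ∀ st ∈ A, ∀ t, Q (trans t st y) := fun A hA hAQ =>
    (eventually_all_finite hA).2 fun st hst => eventually_all.2 fun t => hQ st (hAQ st hst) t
  have hstep : ∀ d : D, ∃ d' : D,
      d'.1.1 = Set.image2 (fun st t => trans t st d.1.2) d.1.1 Set.univ ∧
        R d.1.2 d'.1.2 := by
    rintro ⟨⟨A, y⟩, hA, hAQ, hAt, hy⟩
    have hA' : (Set.image2 (fun st t => trans t st y) A Set.univ).Finite :=
      hA.image2 _ Set.finite_univ
    have hAQ' : ∀ st ∈ Set.image2 (fun st t => trans t st y) A Set.univ, Q st := by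
      rintro _ ⟨st, hst, t, -, rfl⟩
      exact hAt st hst t
    obtain ⟨y', hy1, hy2, hy3⟩ := ((hgen _ hA' hAQ').and (hB.and (hR y hy))).exists
    exact ⟨⟨⟨_, y'⟩, hA', hAQ', hy1, hy2⟩, rfl, hy3⟩
  choose next hnext using hstep
  have hQ₀ : ∀ st ∈ ({st₀} : Set σ), Q st := by
    rintro _ rfl
    exact h₀
  obtain ⟨y₀, hy1, hy2⟩ := ((hgen {st₀} (Set.finite_singleton _) hQ₀).and hB).exists
  let d : ℕ → D := fun n =>
    Nat.rec ⟨⟨{st₀}, y₀⟩, Set.finite_singleton _, hQ₀, hy1, hy2⟩ (fun _ e => next e) n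
  refine ⟨fun n => (d n).1.2, fun n => (d n).1.1, fun n => (d n).2.2.2.2,
    fun n => (hnext (d n)).2, rfl, fun m st t hst => ?_, fun m => (d m).2.2.1⟩
  change _ ∈ (next (d m)).1.1
  rw [(hnext (d m)).1]
  exact ⟨st, hst, t, Set.mem_univ t, rfl⟩

/-- Extending `s` by `m` successively chosen `U`-generic vectors yields a list in `P`. -/
def GenericallyExtends (U : Ultrafilter SupVec) (P : List SupVec → Prop) :
    ℕ → List SupVec → Prop
  | 0, s => P s
  | m + 1, s => ∀ᶠ x in U, GenericallyExtends U P m (s ++ [x])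

theorem exists_genericallyExtends (U : Ultrafilter SupVec) (c : List SupVec → ℕ) (l : ℕ)
    (hc : ∀ s, c s ≤ l) (m : ℕ) :
    ∀ s, ∃ a ∈ Set.Iic l, GenericallyExtends U (fun t => c t = a) m s := by
  induction m with
  | zero => exact fun s => ⟨c s, hc s, rfl⟩
  | succ m ih =>
    intro s
    refine (Ultrafilter.eventually_exists_mem_iff (Set.finite_Iic l)).1 ?_
    exact Eventually.of_forall fun x => ih (s ++ [x])

/-- One step of building a list of block combinations: the state consists of the number of blocks
still to be built, the list of completed blocks and the current partial block. The partial block is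
extended by `shift i y` and, if requested and if its maximum is reached, it is completed. -/
noncomputable def advance (k : ℕ) (t : Fin (k + 1) × Bool) (st : ℕ × List SupVec × SupVec)
    (y : SupVec) : ℕ × List SupVec × SupVec :=
  match st with
  | (0, s, w) => (0, s, w)
  | (m + 1, s, w) =>
    if t.2 = true ∧ ∃ n, k ≤ (w * shift t.1 y) n then (m, s ++ [w * shift t.1 y], 0)
    else (m + 1, s, w * shift t.1 y)

/-- The invariant preserved by `advance`. -/
def GenericState (k : ℕ) (U : Ultrafilter SupVec) (P : List SupVec → Prop) :
    ℕ × List SupVec × SupVec → Prop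
  | (0, s, _) => P s
  | (m + 1, s, w) => ∀ i ≤ k, (i = 0 ∨ ∃ n, k ≤ w n) →
      ∀ᶠ x in U, GenericallyExtends U P m (s ++ [w * shift i x])

theorem GenericallyExtends.genericState {k : ℕ} (hk : 1 ≤ k) {U : Ultrafilter SupVec}
    {P : List SupVec → Prop} {m : ℕ} {s : List SupVec} (h : GenericallyExtends U P m s) :
    GenericState k U P (m, s, 0) := by
  cases m with
  | zero => exact h
  | succ m =>
    rintro i - (rfl | ⟨n, hn⟩)
    · simp only [shift_zero, zero_mul']
      exact h
    · rw [zero_apply] at hn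
      omega

attribute [local instance] Ultrafilter.mul Ultrafilter.semigroup

theorem SupVec.ShiftAbsorbing.eventually_eventually {U : Ultrafilter SupVec}
    (hU : ShiftAbsorbing U) (i j : ℕ) {p : SupVec → Prop}
    (h : ∀ᶠ x in U, p (shift (min i j) x)) :
    ∀ᶠ x in U, ∀ᶠ y in U, p (shift i x * shift j y) := by
  have key : U.map (shift i) * U.map (shift j) = U.map (shift (min i j)) := by
    rcases le_total i j with hij | hij
    · obtain ⟨d, rfl⟩ := Nat.exists_eq_add_of_le hij
      have : U.map (shift (i + d)) = (U.map (shift d)).map (shift i) := by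
        rw [Ultrafilter.map_map]
        congr 1
        funext x
        rw [Function.comp_apply, shift_shift, Nat.add_comm]
      rw [this, ← map_mul_of_hom (shift_mul i), (hU d).1, min_eq_left hij]
    · obtain ⟨d, rfl⟩ := Nat.exists_eq_add_of_le hij
      have : U.map (shift (j + d)) = (U.map (shift d)).map (shift j) := by
        rw [Ultrafilter.map_map]
        congr 1
        funext x
        rw [Function.comp_apply, shift_shift, Nat.add_comm]
      rw [this, ← map_mul_of_hom (shift_mul j), (hU d).2, min_eq_right hij]
  have h' : ∀ᶠ x in (U.map (shift (min i j)) : Filter SupVec), p x := h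
  rw [← key, Ultrafilter.eventually_mul] at h'
  exact h'

theorem GenericState.eventually_advance {k : ℕ} (hk : 1 ≤ k) {U : Ultrafilter SupVec}
    (hU : ShiftAbsorbing U) (hUk : ∀ᶠ y : SupVec in U, ∀ n, y n ≤ k) {P : List SupVec → Prop}
    {st : ℕ × List SupVec × SupVec} (h : GenericState k U P st) (t : Fin (k + 1) × Bool) :
    ∀ᶠ y in U, GenericState k U P (advance k t st y) := by
  obtain ⟨m, s, w⟩ := st
  obtain ⟨⟨i, hi⟩, b⟩ := t
  cases m with
  | zero => exact Eventually.of_forall fun y => h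
  | succ m =>
    have hreach : ∀ y : SupVec, (∀ n, y n ≤ k) → ∀ n, k ≤ (w * shift i y) n →
        i = 0 ∨ ∃ n, k ≤ w n := fun y hy n hn => by
      have := hy n
      rw [mul_apply, shift_apply] at hn
      rcases le_max_iff.1 hn with h1 | h1
      · exact Or.inr ⟨n, h1⟩
      · left
        omega
    have hcomplete : ∀ᶠ y in U, (i = 0 ∨ ∃ n, k ≤ w n) →
        GenericallyExtends U P m (s ++ [w * shift i y]) :=
      eventually_imp_distrib_left.2 (h i (Nat.le_of_lt_succ hi))
    have hcontinue : ∀ᶠ y in U, ∀ j : Fin (k + 1), ((j : ℕ) = 0 ∨ i = 0 ∨ ∃ n, k ≤ w n) →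
        ∀ᶠ x in U, GenericallyExtends U P m (s ++ [w * shift i y * shift j x]) := by
      refine eventually_all.2 fun j => eventually_imp_distrib_left.2 fun hj => ?_
      simp only [mul_assoc]
      refine hU.eventually_eventually i j
        (p := fun x => GenericallyExtends U P m (s ++ [w * x])) 
        (h _ ((min_le_left _ _).trans (Nat.le_of_lt_succ hi)) ?_)
      rcases hj with hj | hj | hj
      · left
        omega
      · left
        omega
      · exact Or.inr hj
    filter_upwards [hUk, hcomplete, hcontinue] with y hy h1 h2
    simp only [advance]
    split_ifs with hc
    · obtain ⟨n, hn⟩ := hc.2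
      exact (h1 (hreach y hy n hn)).genericState hk
    · rintro j hjk hj
      refine h2 ⟨j, Nat.lt_succ_of_le hjk⟩ (hj.imp_right ?_)
      rintro ⟨n, hn⟩
      exact hreach y hy n hn

theorem IsBlockSeq.mem_of_partialSum {k : ℕ} (hk : 1 ≤ k) {Y : ℕ → ℕ → ℕ} (hY : IsBlockSeq k Y)
    {S : ℕ → Set (ℕ × List SupVec × SupVec)}
    (hS : ∀ m st t, st ∈ S m → advance k t st (Y m) ∈ S (m + 1)) {E : ℕ → ℕ} {a b m : ℕ}
    {s : List SupVec} (hst : (m + 1, s, 0) ∈ S a) (hEk : ∀ i, E i ≤ k)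
    (hEa : ∀ i, E i < k → a ≤ i) (hEb : E b < k) (hfin : IsFin k (partialSum Y E (b + 1))) :
    (m, s ++ [partialSum Y E (b + 1)], 0) ∈ S (b + 1) := by
  have hpartial : ∀ r, a ≤ r → (m + 1, s, partialSum Y E r) ∈ S r := by
    intro r hr
    induction r, hr using Nat.le_induction with
    | base =>
      rwa [hY.partialSum_eq_zero fun i hi => ?_]
      by_contra h
      exact absurd (hEa i (not_le.1 h)) (not_le.2 hi)
    | succ r _ ih =>
      have := hS r _ (⟨E r, Nat.lt_succ_of_le (hEk r)⟩, false) ih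
      rw [hY.partialSum_succ hk]
      simpa [advance] using this
  have := hS b _ (⟨E b, Nat.lt_succ_of_le (hEk b)⟩, true) (hpartial b (hEa b hEb))
  rw [hY.partialSum_succ hk] at hfin ⊢
  obtain ⟨n, hn⟩ := hfin.exists_eq
  simp only [advance] at this
  rwa [if_pos ⟨trivial, n, hn.ge⟩] at this

theorem BlockLE.mem_of_restrictN {k : ℕ} (hk : 1 ≤ k) {Y Z : ℕ → ℕ → ℕ} (hY : IsBlockSeq k Y)
    (hZ : BlockLE k Z Y) {S : ℕ → Set (ℕ × List SupVec × SupVec)}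
    (hS : ∀ m st t, st ∈ S m → advance k t st (Y m) ∈ S (m + 1)) {n : ℕ}
    (h₀ : (n, [], 0) ∈ S 0) : ∃ a, (0, restrictN Z n, 0) ∈ S a := by
  choose E b hEk hEb hEmax hZE using fun j => hY.exists_partialSum hk (hZ.2 j)
  have hlt : ∀ j i, E (j + 1) i < k → b j < i := by
    intro j i hi
    have hne : ∀ j i p, E j i < k → Y i p = k → Z j p ≠ 0 := by
      intro j i p hi hp h
      rw [hZE j] at h
      have := Finset.sum_eq_zero_iff.1 h i
        (Finset.mem_range.2 (Nat.lt_succ_of_le (hEmax j i hi)))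
      simp only [Tmap, hp] at this
      omega
    obtain ⟨p, hp⟩ := (hY.1 (b j)).exists_eq
    obtain ⟨q, hq⟩ := (hY.1 i).exists_eq
    have hpq : p < q := hZ.1.2 j p q (hne _ _ _ (hEb j) hp) (hne _ _ _ hi hq)
    by_contra hle
    rcases (not_lt.1 hle).lt_or_eq with h | rfl
    · exact absurd (hY.vecLt hk h q p (by omega) (by omega)) (by omega)
    · exact absurd (hZ.1.2 j q p (hne _ _ _ (hEb j) hq) (hne _ _ _ hi hp)) (by omega)
  have key : ∀ j m, j + m = n →
      ∃ a, (m, restrictN Z j, 0) ∈ S a ∧ ∀ i, E j i < k → a ≤ i := by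
    intro j
    induction j with
    | zero =>
      rintro m hm
      obtain rfl : m = n := by omega
      exact ⟨0, h₀, fun _ _ => Nat.zero_le _⟩
    | succ j ih =>
      intro m hm
      obtain ⟨a, ha, hai⟩ := ih (m + 1) (by omega)
      refine ⟨b j + 1, ?_, hlt j⟩
      have := hY.mem_of_partialSum hk hS ha (hEk j) hai (hEb j) (hZE j ▸ hZ.1.1 j)
      rw [← hZE j] at this
      rw [restrictN, List.range_succ, List.map_append]
      exact this
  obtain ⟨a, ha, -⟩ := key n 0 rfl
  exact ⟨a, ha⟩

end Fusion

/-- Finite colorings of `𝒜X_n` are constant on `𝒜Y_n` for some `Y ≤ X`. -/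
theorem statement1 (k : ℕ) (hk : 1 ≤ k) (X : ℕ → ℕ → ℕ) (hX : IsBlockSeq k X)
    (n l : ℕ) (c : List (ℕ → ℕ) → ℕ) (hc : ∀ s ∈ ApproxN k X n, c s < l) :
    ∃ Y, BlockLE k Y X ∧ ∀ s ∈ ApproxN k Y n, ∀ t ∈ ApproxN k Y n, c s = c t := by
  obtain ⟨U, hU, hUX, hUinf⟩ := hX.exists_shiftAbsorbing
  obtain ⟨a, -, ha⟩ := exists_genericallyExtends U (fun s => min (c s) l) l
    (fun s => min_le_right _ _) n []
  have hUk : ∀ᶠ y : SupVec in U, ∀ p, y p ≤ k := by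
    filter_upwards [hUX] with y hy
    obtain ⟨v, hv, rfl⟩ := hy
    exact (hX.isFin_realize hk hv).1
  obtain ⟨Y, S, hYB, hYlt, h₀, hS, hQ⟩ := exists_generic_sequence U (advance k)
    (GenericState k U fun s => min (c s) l = a)
    (fun st hst t => hst.eventually_advance hk hU hUk t)
    (fun y => ∃ v : SupVec, IsFin k v ∧ y = realize k X v) hUX (fun y y' => VecLt y y')
    (by
      rintro _ ⟨v, hv, rfl⟩
      obtain ⟨M, hM⟩ := (hX.isFin_realize hk hv).2.1.bddAbove
      filter_upwards [hUinf M] with y hy p q hp hq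
      by_contra hle
      exact hq (hy q ((not_lt.1 hle).trans (hM hp))))
    (n, [], 0) (ha.genericState hk)
  have hY : IsBlockSeq k Y := by
    refine ⟨fun i => ?_, hYlt⟩
    obtain ⟨v, hv, hvY⟩ := hYB i
    rw [hvY]
    exact hX.isFin_realize hk hv
  have hcolor : ∀ s ∈ ApproxN k Y n, c s = a := by
    rintro _ ⟨Z, hZ, rfl⟩
    obtain ⟨r, hr⟩ := hZ.mem_of_restrictN hk hY hS h₀
    have h1 : min (c (restrictN Z n)) l = a := hQ r _ hr
    have h2 := hc _ ⟨Z, ⟨hZ.1, fun j => (hZ.2 j).of_realize hk hX hY hYB (hZ.1.1 j)⟩, rfl⟩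
    rwa [min_eq_left h2.le] at h1
  refine ⟨Y, ⟨hY, fun i => ?_⟩, fun s hs t ht => (hcolor s hs).trans (hcolor t ht).symm⟩
  obtain ⟨v, hv, hvY⟩ := hYB i
  rw [hvY]
  exact hX.inSubspace_realize hk hv
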